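/- arXiv:1609.05126 — 3 statements merged into one kernel-verified Lean document; each statement's English description precedes it below -/
import Mathlib

section
/- Let n ≥ 1, a ∈ ℝ, and for (x,y) ∈ ℝⁿ × ℝⁿ set d_M(x,y) = ∑_{j=1}^n (x_j − a y_j)²/(1+a²) and d_N(x,y) = ∑_{j=1}^n y_j². If |a| ≤ 1/√15, then the function ρ(z) = d_M(z)² d_N(z) + d_M(z) d_N(z)², viewed as a function on ℂⁿ ≅ ℝ²ⁿ, is strictly plurisubharmonic at every point of ℂⁿ ∖ {0}. -/
open Complex

/-- Partial derivative in the direction `x_j`, identifying `ℂⁿ ≅ ℝⁿ × ℝⁿ`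
via `z_j = x_j + i y_j`. -/
noncomputable def pderivX {n : ℕ} (j : Fin n)
    (f : (Fin n → ℝ) × (Fin n → ℝ) → ℝ) : (Fin n → ℝ) × (Fin n → ℝ) → ℝ :=
  fun p => deriv (fun t => f (Function.update p.1 j t, p.2)) (p.1 j)

/-- Partial derivative in the direction `y_j`. -/
noncomputable def pderivY {n : ℕ} (j : Fin n)
    (f : (Fin n → ℝ) × (Fin n → ℝ) → ℝ) : (Fin n → ℝ) × (Fin n → ℝ) → ℝ :=
  fun p => deriv (fun t => f (p.1, Function.update p.2 j t)) (p.2 j)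

/-- The entry `∂²f/∂z_j∂z̄_k` of the complex Hessian (Levi form) of `f`. -/
noncomputable def leviEntry {n : ℕ} (j k : Fin n)
    (f : (Fin n → ℝ) × (Fin n → ℝ) → ℝ) (p : (Fin n → ℝ) × (Fin n → ℝ)) : ℂ :=
  (1/4 : ℂ) * (((pderivX j (pderivX k f) p + pderivY j (pderivY k f) p : ℝ) : ℂ)
    + Complex.I * ((pderivX j (pderivY k f) p - pderivY j (pderivX k f) p : ℝ) : ℂ))

/-- `f` is strictly plurisubharmonic at `p` if its Levi form is positive definite. -/
def StrictlyPlurisubharmonicAt {n : ℕ}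
    (f : (Fin n → ℝ) × (Fin n → ℝ) → ℝ) (p : (Fin n → ℝ) × (Fin n → ℝ)) : Prop :=
  ∀ ξ : Fin n → ℂ, ξ ≠ 0 →
    0 < (∑ j, ∑ k, leviEntry j k f p * ξ j * (starRingEnd ℂ) (ξ k)).re

section helpers
variable {n : ℕ}

noncomputable def dMf (a : ℝ) (p : (Fin n → ℝ) × (Fin n → ℝ)) : ℝ :=
  ∑ j, (p.1 j - a * p.2 j) ^ 2 / (1 + a ^ 2)

noncomputable def dNf (p : (Fin n → ℝ) × (Fin n → ℝ)) : ℝ := ∑ j, (p.2 j) ^ 2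

noncomputable def rhof (a : ℝ) (p : (Fin n → ℝ) × (Fin n → ℝ)) : ℝ :=
  (dMf a p) ^ 2 * dNf p + dMf a p * (dNf p) ^ 2

lemma coord_hasDeriv (v : Fin n → ℝ) (j k : Fin n) :
    HasDerivAt (fun t => Function.update v j t k) (if j = k then 1 else 0) (v j) := by
  by_cases h : j = k
  · subst h
    simpa using hasDerivAt_id' (v j)
  · have h' : k ≠ j := fun e => h e.symm
    simpa [Function.update_of_ne h', h] using hasDerivAt_const (v j) (v k)

lemma M_X (a : ℝ) (p : (Fin n → ℝ) × (Fin n → ℝ)) (j : Fin n) :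
    HasDerivAt (fun t => dMf a (Function.update p.1 j t, p.2))
      (2 * (p.1 j - a * p.2 j) / (1 + a ^ 2)) (p.1 j) := by
  unfold dMf
  have h := HasDerivAt.fun_sum (u := Finset.univ) (fun (k : Fin n) _ =>
    (((coord_hasDeriv p.1 j k).sub_const (a * p.2 k)).pow 2).div_const (1 + a ^ 2))
  refine h.congr_deriv ?_
  simp [mul_ite, ite_div, Finset.sum_ite_eq]

lemma M_Y (a : ℝ) (p : (Fin n → ℝ) × (Fin n → ℝ)) (j : Fin n) :
    HasDerivAt (fun t => dMf a (p.1, Function.update p.2 j t))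
      (2 * (p.1 j - a * p.2 j) * (-a) / (1 + a ^ 2)) (p.2 j) := by
  unfold dMf
  have h := HasDerivAt.fun_sum (u := Finset.univ) (fun (k : Fin n) _ =>
    ((((coord_hasDeriv p.2 j k).const_mul a).const_sub (p.1 k)).pow 2).div_const (1 + a ^ 2))
  refine h.congr_deriv ?_
  rw [Finset.sum_eq_single j]
  · simp
  · intro b _ hb
    simp [hb.symm]
  · simp

lemma N_Y (p : (Fin n → ℝ) × (Fin n → ℝ)) (j : Fin n) :
    HasDerivAt (fun t => dNf (p.1, Function.update p.2 j t))
      (2 * p.2 j) (p.2 j) := by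
  unfold dNf
  have h := HasDerivAt.fun_sum (u := Finset.univ) (fun (k : Fin n) _ =>
    ((coord_hasDeriv p.2 j k).pow 2))
  refine h.congr_deriv ?_
  simp [mul_ite, Finset.sum_ite_eq]

lemma N_X (p : (Fin n → ℝ) × (Fin n → ℝ)) (j : Fin n) :
    HasDerivAt (fun t => dNf (Function.update p.1 j t, p.2)) 0 (p.1 j) := by
  simpa [dNf] using hasDerivAt_const (p.1 j) (dNf p)

lemma pX (a : ℝ) (k : Fin n) : pderivX k (rhof a) = fun p : (Fin n → ℝ) × (Fin n → ℝ) =>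
    (2 * dMf a p * dNf p + dNf p ^ 2) * (2 * (p.1 k - a * p.2 k) / (1 + a ^ 2)) := by
  funext p
  have h := (((M_X a p k).fun_pow 2).fun_mul (N_X p k)).fun_add
    ((M_X a p k).fun_mul ((N_X p k).fun_pow 2))
  have := h.deriv
  simp only [Function.update_eq_self] at this
  unfold pderivX rhof
  rw [this]
  simp
  ring

lemma pY (a : ℝ) (k : Fin n) : pderivY k (rhof a) = fun p : (Fin n → ℝ) × (Fin n → ℝ) =>
    (2 * dMf a p * dNf p + dNf p ^ 2) * (2 * (p.1 k - a * p.2 k) * (-a) / (1 + a ^ 2))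
    + (dMf a p ^ 2 + 2 * dMf a p * dNf p) * (2 * p.2 k) := by
  funext p
  have h := (((M_Y a p k).fun_pow 2).fun_mul (N_Y p k)).fun_add
    ((M_Y a p k).fun_mul ((N_Y p k).fun_pow 2))
  have := h.deriv
  simp only [Function.update_eq_self] at this
  unfold pderivY rhof
  rw [this]
  simp
  ring

lemma pXX (a : ℝ) (j k : Fin n) (p : (Fin n → ℝ) × (Fin n → ℝ)) :
    pderivX j (pderivX k (rhof a)) p =
      2 * dNf p * (2 * (p.1 j - a * p.2 j) / (1 + a ^ 2)) * (2 * (p.1 k - a * p.2 k) / (1 + a ^ 2))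
      + (2 * dMf a p * dNf p + dNf p ^ 2) * (2 * (if j = k then 1 else 0) / (1 + a ^ 2)) := by
  rw [pX]
  have := ((((((M_X a p j).const_mul 2).fun_mul (N_X p j)).fun_add ((N_X p j).fun_pow 2))).fun_mul ((((coord_hasDeriv p.1 j k).sub_const (a * p.2 k)).const_mul 2).div_const (1 + a ^ 2))).deriv
  simp only [Function.update_eq_self] at this
  unfold pderivX
  rw [this]
  simp only [Nat.cast_ofNat]
  ring

lemma pYX (a : ℝ) (j k : Fin n) (p : (Fin n → ℝ) × (Fin n → ℝ)) :
    pderivY j (pderivX k (rhof a)) p =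
      (2 * dNf p * (2 * (p.1 j - a * p.2 j) * (-a) / (1 + a ^ 2))
        + (2 * dMf a p + 2 * dNf p) * (2 * p.2 j)) * (2 * (p.1 k - a * p.2 k) / (1 + a ^ 2))
      + (2 * dMf a p * dNf p + dNf p ^ 2) *
        (2 * (-a * (if j = k then 1 else 0)) / (1 + a ^ 2)) := by
  rw [pX]
  have := ((((((M_Y a p j).const_mul 2).fun_mul (N_Y p j)).fun_add ((N_Y p j).fun_pow 2))).fun_mul
      (((((coord_hasDeriv p.2 j k).const_mul a).const_sub (p.1 k)).const_mul 2).div_const (1 + a ^ 2))).deriv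
  simp only [Function.update_eq_self] at this
  unfold pderivY
  rw [this]
  simp only [Nat.cast_ofNat]
  ring

lemma pXY (a : ℝ) (j k : Fin n) (p : (Fin n → ℝ) × (Fin n → ℝ)) :
    pderivX j (pderivY k (rhof a)) p =
      2 * dNf p * (2 * (p.1 j - a * p.2 j) / (1 + a ^ 2))
        * (2 * (p.1 k - a * p.2 k) * (-a) / (1 + a ^ 2))
      + (2 * dMf a p * dNf p + dNf p ^ 2) * (2 * (if j = k then 1 else 0) * (-a) / (1 + a ^ 2))
      + (2 * dMf a p + 2 * dNf p) * (2 * (p.1 j - a * p.2 j) / (1 + a ^ 2)) * (2 * p.2 k) := by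
  rw [pY]
  have := (((((((M_X a p j).const_mul 2).fun_mul (N_X p j)).fun_add ((N_X p j).fun_pow 2))).fun_mul
      (((((coord_hasDeriv p.1 j k).sub_const (a * p.2 k)).const_mul 2).mul_const (-a)).div_const (1 + a ^ 2))).fun_add ((((M_X a p j).fun_pow 2).fun_add
    (((M_X a p j).const_mul 2).fun_mul (N_X p j))).mul_const (2 * p.2 k))).deriv
  simp only [Function.update_eq_self] at this
  unfold pderivX
  rw [this]
  simp only [Nat.cast_ofNat]
  ring

lemma pYY (a : ℝ) (j k : Fin n) (p : (Fin n → ℝ) × (Fin n → ℝ)) :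
    pderivY j (pderivY k (rhof a)) p =
      (2 * dNf p * (2 * (p.1 j - a * p.2 j) * (-a) / (1 + a ^ 2))
        + (2 * dMf a p + 2 * dNf p) * (2 * p.2 j))
        * (2 * (p.1 k - a * p.2 k) * (-a) / (1 + a ^ 2))
      + (2 * dMf a p * dNf p + dNf p ^ 2) *
        (2 * (-a * (if j = k then 1 else 0)) * (-a) / (1 + a ^ 2))
      + ((2 * dMf a p + 2 * dNf p) * (2 * (p.1 j - a * p.2 j) * (-a) / (1 + a ^ 2))
        + 2 * dMf a p * (2 * p.2 j)) * (2 * p.2 k)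
      + (dMf a p ^ 2 + 2 * dMf a p * dNf p) * (2 * (if j = k then 1 else 0)) := by
  rw [pY]
  have := (((((((M_Y a p j).const_mul 2).fun_mul (N_Y p j)).fun_add ((N_Y p j).fun_pow 2))).fun_mul ((((((coord_hasDeriv p.2 j k).const_mul a).const_sub (p.1 k)).const_mul 2).mul_const (-a)).div_const (1 + a ^ 2))).fun_add ((((M_Y a p j).fun_pow 2).fun_add
    (((M_Y a p j).const_mul 2).fun_mul (N_Y p j))).fun_mul
      ((coord_hasDeriv p.2 j k).const_mul 2))).deriv
  simp only [Function.update_eq_self] at this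
  unfold pderivY
  rw [this]
  simp only [Nat.cast_ofNat]
  ring

noncomputable def Av (a : ℝ) (p : (Fin n → ℝ) × (Fin n → ℝ)) (j : Fin n) : ℂ :=
  ⟨(p.1 j - a * p.2 j) / (1 + a ^ 2), a * ((p.1 j - a * p.2 j) / (1 + a ^ 2))⟩

noncomputable def Bv (p : (Fin n → ℝ) × (Fin n → ℝ)) (j : Fin n) : ℂ := ⟨0, - p.2 j⟩

lemma entry (a : ℝ) (j k : Fin n) (p : (Fin n → ℝ) × (Fin n → ℝ)) :
    leviEntry j k (rhof a) p =
      (if j = k then (((dMf a p ^ 2 + 4 * dMf a p * dNf p + dNf p ^ 2) / 2 : ℝ) : ℂ) else 0)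
      + ((2 * dNf p : ℝ) : ℂ) * (Av a p j * (starRingEnd ℂ) (Av a p k))
      + ((2 * dMf a p : ℝ) : ℂ) * (Bv p j * (starRingEnd ℂ) (Bv p k))
      + ((2 * dMf a p + 2 * dNf p : ℝ) : ℂ) * (Av a p j * (starRingEnd ℂ) (Bv p k)
        + Bv p j * (starRingEnd ℂ) (Av a p k)) := by
  unfold leviEntry
  rw [pXX, pXY, pYX, pYY]
  have h0 : (1 + a ^ 2) ≠ 0 := by positivity
  generalize dMf a p = M
  generalize dNf p = N
  have e4 : (1/4 : ℂ) = ((1/4 : ℝ) : ℂ) := by push_cast; rfl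
  rw [e4]
  split_ifs with h
  · subst h
    apply Complex.ext
    · simp only [Av, Bv, Complex.add_re, Complex.add_im, Complex.mul_re, Complex.mul_im,
        Complex.ofReal_re, Complex.ofReal_im, Complex.I_re, Complex.I_im, Complex.conj_re,
        Complex.conj_im, Complex.zero_re, Complex.zero_im]
      field_simp
      ring
    · simp only [Av, Bv, Complex.add_re, Complex.add_im, Complex.mul_re, Complex.mul_im,
        Complex.ofReal_re, Complex.ofReal_im, Complex.I_re, Complex.I_im, Complex.conj_re,
        Complex.conj_im, Complex.zero_re, Complex.zero_im]
      field_simp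
      ring
  · apply Complex.ext
    · simp only [Av, Bv, Complex.add_re, Complex.add_im, Complex.mul_re, Complex.mul_im,
        Complex.ofReal_re, Complex.ofReal_im, Complex.I_re, Complex.I_im, Complex.conj_re,
        Complex.conj_im, Complex.zero_re, Complex.zero_im]
      field_simp
      ring
    · simp only [Av, Bv, Complex.add_re, Complex.add_im, Complex.mul_re, Complex.mul_im,
        Complex.ofReal_re, Complex.ofReal_im, Complex.I_re, Complex.I_im, Complex.conj_re,
        Complex.conj_im, Complex.zero_re, Complex.zero_im]
      field_simp
      ring

lemma levi_sum (a : ℝ) (p : (Fin n → ℝ) × (Fin n → ℝ)) (ξ : Fin n → ℂ) :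
    (∑ j, ∑ k, leviEntry j k (rhof a) p * ξ j * (starRingEnd ℂ) (ξ k)).re =
      (dMf a p ^ 2 + 4 * dMf a p * dNf p + dNf p ^ 2) / 2 * ∑ j, normSq (ξ j)
      + 2 * dNf p * normSq (∑ j, Av a p j * ξ j)
      + 2 * dMf a p * normSq (∑ j, Bv p j * ξ j)
      + 4 * (dMf a p + dNf p) *
        ((∑ j, Av a p j * ξ j) * (starRingEnd ℂ) (∑ j, Bv p j * ξ j)).re := by
  set A := ∑ j, Av a p j * ξ j with hA
  set B := ∑ j, Bv p j * ξ j with hB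
  have hs : ∀ (f g : Fin n → ℂ), ∑ j, ∑ k, (f j * (starRingEnd ℂ) (g k)) * ξ j *
      (starRingEnd ℂ) (ξ k) = (∑ j, f j * ξ j) * (starRingEnd ℂ) (∑ j, g j * ξ j) := by
    intro f g
    rw [map_sum, Finset.sum_mul_sum]
    refine Finset.sum_congr rfl fun j _ => Finset.sum_congr rfl fun k _ => ?_
    rw [map_mul]; ring
  have key : ∑ j, ∑ k, leviEntry j k (rhof a) p * ξ j * (starRingEnd ℂ) (ξ k) =
      (((dMf a p ^ 2 + 4 * dMf a p * dNf p + dNf p ^ 2) / 2 : ℝ) : ℂ) *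
        ((∑ j, normSq (ξ j) : ℝ) : ℂ)
      + ((2 * dNf p : ℝ) : ℂ) * (A * (starRingEnd ℂ) A)
      + ((2 * dMf a p : ℝ) : ℂ) * (B * (starRingEnd ℂ) B)
      + ((2 * dMf a p + 2 * dNf p : ℝ) : ℂ) * (A * (starRingEnd ℂ) B
        + B * (starRingEnd ℂ) A) := by
    rw [hA, hB, ← hs, ← hs, ← hs, ← hs, Complex.ofReal_sum]
    simp only [Finset.mul_sum, ← Finset.sum_add_distrib]
    refine Finset.sum_congr rfl fun j _ => ?_
    rw [← add_zero (∑ k, _)]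
    simp only [entry, add_mul, Finset.sum_add_distrib, ite_mul, zero_mul, Finset.sum_ite_eq,
      Finset.mem_univ, if_true, ← Complex.mul_conj, mul_add, add_zero, mul_assoc]
  rw [key]
  simp only [Complex.mul_conj]
  simp only [Complex.add_re, Complex.ofReal_re, Complex.ofReal_im, Complex.mul_re,
    Complex.conj_re, Complex.conj_im]
  ring

lemma cs (f ξ : Fin n → ℂ) :
    normSq (∑ j, f j * ξ j) ≤ (∑ j, normSq (f j)) * ∑ j, normSq (ξ j) := by
  simp only [Complex.normSq_eq_norm_sq]
  calc ‖∑ j, f j * ξ j‖ ^ 2 ≤ (∑ j, ‖f j‖ * ‖ξ j‖) ^ 2 := by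
        gcongr
        refine (norm_sum_le _ _).trans (le_of_eq ?_)
        simp
    _ ≤ _ := Finset.sum_mul_sq_le_sq_mul_sq _ _ _

lemma sumA (a : ℝ) (p : (Fin n → ℝ) × (Fin n → ℝ)) (m k : ℝ) :
    ∑ j, normSq ((k : ℂ) * Av a p j - (m : ℂ) * Bv p j) =
      k ^ 2 * dMf a p + m ^ 2 * dNf p
      + 2 * m * k * (a * ∑ j, (p.1 j - a * p.2 j) * p.2 j / (1 + a ^ 2)) := by
  unfold dMf dNf
  simp only [Finset.mul_sum, ← Finset.sum_add_distrib]
  refine Finset.sum_congr rfl fun j _ => ?_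
  have h0 : (1 + a ^ 2) ≠ 0 := by positivity
  simp [Av, Bv, Complex.normSq_apply]
  field_simp
  ring

lemma cross (a : ℝ) (ha : |a| ≤ 1 / Real.sqrt 15) (p : (Fin n → ℝ) × (Fin n → ℝ)) :
    (a * ∑ j, (p.1 j - a * p.2 j) * p.2 j / (1 + a ^ 2)) ^ 2 ≤ dMf a p * dNf p / 16 := by
  have h15 : a ^ 2 ≤ 1 / 15 := by
    have h := pow_le_pow_left₀ (abs_nonneg a) ha 2
    rw [sq_abs, div_pow, Real.sq_sqrt (by norm_num)] at h
    simpa using h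
  have h := Finset.sum_mul_sq_le_sq_mul_sq Finset.univ (fun j => p.1 j - a * p.2 j) p.2
  unfold dMf dNf
  rw [← Finset.sum_div, ← Finset.sum_div]
  set S := ∑ j, (p.1 j - a * p.2 j) * p.2 j
  set X := ∑ j, (p.1 j - a * p.2 j) ^ 2
  set Y := ∑ j, p.2 j ^ 2
  have hXY : 0 ≤ X * Y := le_trans (sq_nonneg S) h
  have h0 : 0 < (1 + a ^ 2) := by positivity
  have e1 : (a * (S / (1 + a ^ 2))) ^ 2 = a ^ 2 * S ^ 2 / (1 + a ^ 2) ^ 2 := by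
    field_simp
  have e2 : X / (1 + a ^ 2) * Y / 16 = (X * Y * (1 + a ^ 2) / 16) / (1 + a ^ 2) ^ 2 := by
    field_simp
  rw [e1, e2]
  gcongr
  nlinarith [mul_le_mul_of_nonneg_left h (sq_nonneg a), mul_le_mul_of_nonneg_right h15 hXY]

lemma final_ineq (M N m k S α R : ℝ) (A B : ℂ) (hm : 0 ≤ m) (hk : 0 ≤ k) (hM : M = m ^ 2)
    (hN : N = k ^ 2) (hpos : 0 < M + N) (hS : 0 < S) (hα : α ^ 2 ≤ M * N / 16)
    (hR : R = (A * (starRingEnd ℂ) B).re)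
    (hcs : normSq ((k : ℂ) * A - (m : ℂ) * B) ≤ (k ^ 2 * M + m ^ 2 * N + 2 * m * k * α) * S)
    (hA0 : M = 0 → A = 0) (hB0 : N = 0 → B = 0) :
    0 < (M ^ 2 + 4 * M * N + N ^ 2) / 2 * S + 2 * N * normSq A + 2 * M * normSq B
      + 4 * (M + N) * R := by
  have hnA := Complex.normSq_nonneg A
  have hnB := Complex.normSq_nonneg B
  have hM0 : 0 ≤ M := by rw [hM]; positivity
  have hN0 : 0 ≤ N := by rw [hN]; positivity
  by_cases hz : M = 0 ∨ N = 0
  · have hR0 : R = 0 := by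
      rcases hz with h | h
      · rw [hR, hA0 h]; simp
      · rw [hR, hB0 h]; simp
    have : 0 < (M ^ 2 + 4 * M * N + N ^ 2) / 2 * S := by
      apply mul_pos _ hS
      nlinarith [mul_nonneg hM0 hN0, mul_pos hpos hpos]
    rw [hR0]
    have h1 := mul_nonneg hN0 hnA
    have h2 := mul_nonneg hM0 hnB
    linarith
  push Not at hz
  have hm' : 0 < m := lt_of_le_of_ne hm (fun h => hz.1 (by rw [hM, ← h]; ring))
  have hk' : 0 < k := lt_of_le_of_ne hk (fun h => hz.2 (by rw [hN, ← h]; ring))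
  have hmk : 0 < m * k := mul_pos hm' hk'
  subst hM hN
  have e1 : normSq ((k : ℂ) * A - (m : ℂ) * B) =
      k ^ 2 * normSq A + m ^ 2 * normSq B - 2 * (m * k) * R := by
    rw [hR]; simp [Complex.normSq_apply]; ring
  have e2 : normSq ((k : ℂ) * A + (m : ℂ) * B) =
      k ^ 2 * normSq A + m ^ 2 * normSq B + 2 * (m * k) * R := by
    rw [hR]; simp [Complex.normSq_apply]; ring
  have h2 := Complex.normSq_nonneg ((k : ℂ) * A + (m : ℂ) * B)
  rw [e2] at h2
  rw [e1] at hcs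
  have hα' : α ≤ m * k / 4 := by
    apply le_of_sq_le_sq _ (by positivity) 
    nlinarith
  -- lower bound on R
  have hRl : -(5 / 8 * (m * k) * S) ≤ R := by
    have : 2 * m * k * α * S ≤ 2 * (m * k) * (m * k / 4) * S := by
      have := mul_le_mul_of_nonneg_left hα' (by positivity : 0 ≤ 2 * (m * k) * S)
      linarith
    have h3 : (m * k) * (-(5 / 8 * (m * k) * S)) ≤ (m * k) * R := by nlinarith
    exact le_of_mul_le_mul_left h3 hmk
  have hq : 0 ≤ m ^ 2 + k ^ 2 - m * k := by nlinarith [sq_nonneg (m - k)]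
  have h4 := mul_le_mul_of_nonneg_left hRl hq
  have hpoly : 0 < (m ^ 4 + 4 * m ^ 2 * k ^ 2 + k ^ 4) / 2
      - 5 / 2 * (m ^ 2 + k ^ 2 - m * k) * (m * k) := by
    have : (m ^ 4 + 4 * m ^ 2 * k ^ 2 + k ^ 4) / 2
      - 5 / 2 * (m ^ 2 + k ^ 2 - m * k) * (m * k) =
      (m ^ 2 + k ^ 2 - 5 / 2 * (m * k)) ^ 2 / 2 + 3 / 8 * (m * k) ^ 2 := by ring
    rw [this]; positivity
  have h5 := mul_pos hpoly hS
  nlinarith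

end helpers

/-- For `M = (aI + iI)ℝⁿ` with `|a| ≤ 1/√15`, the function
`ρ = d_M² d_N + d_M d_N²` is strictly plurisubharmonic on `ℂⁿ ∖ {0}`. -/
theorem psh_of_small_a (n : ℕ) (hn : 1 ≤ n) (a : ℝ)
    (ha : |a| ≤ 1 / Real.sqrt 15) :
    let dM : (Fin n → ℝ) × (Fin n → ℝ) → ℝ :=
      fun p => ∑ j, (p.1 j - a * p.2 j) ^ 2 / (1 + a ^ 2)
    let dN : (Fin n → ℝ) × (Fin n → ℝ) → ℝ := fun p => ∑ j, (p.2 j) ^ 2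
    let ρ : (Fin n → ℝ) × (Fin n → ℝ) → ℝ :=
      fun p => (dM p) ^ 2 * dN p + dM p * (dN p) ^ 2
    ∀ p : (Fin n → ℝ) × (Fin n → ℝ), p ≠ 0 → StrictlyPlurisubharmonicAt ρ p := by
  intro dM dN ρ p hp ξ hξ
  change 0 < (∑ j, ∑ k, leviEntry j k (rhof a) p * ξ j * (starRingEnd ℂ) (ξ k)).re
  rw [levi_sum]
  have h0 : 0 < (1 + a ^ 2) := by positivity
  have hM0 : 0 ≤ dMf a p := Finset.sum_nonneg fun j _ => by positivity
  have hN0 : 0 ≤ dNf p := Finset.sum_nonneg fun j _ => by positivity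
  have hMz : dMf a p = 0 → ∀ j, p.1 j - a * p.2 j = 0 := by
    intro h j
    have := (Finset.sum_eq_zero_iff_of_nonneg (fun j _ => by positivity)).1 h j (Finset.mem_univ j)
    rcases div_eq_zero_iff.1 this with h | h
    · exact pow_eq_zero_iff (by norm_num) |>.1 h
    · exact absurd h h0.ne'
  have hNz : dNf p = 0 → ∀ j, p.2 j = 0 := by
    intro h j
    have := (Finset.sum_eq_zero_iff_of_nonneg (fun j _ => by positivity)).1 h j (Finset.mem_univ j)
    exact pow_eq_zero_iff (by norm_num) |>.1 this
  have hS : 0 < ∑ j, normSq (ξ j) := by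
    obtain ⟨j, hj⟩ := Function.ne_iff.1 hξ
    exact Finset.sum_pos' (fun j _ => Complex.normSq_nonneg _)
      ⟨j, Finset.mem_univ j, Complex.normSq_pos.2 hj⟩
  refine final_ineq (dMf a p) (dNf p) (Real.sqrt (dMf a p)) (Real.sqrt (dNf p)) _
    (a * ∑ j, (p.1 j - a * p.2 j) * p.2 j / (1 + a ^ 2)) _ _ _
    (Real.sqrt_nonneg _) (Real.sqrt_nonneg _) (Real.sq_sqrt hM0).symm (Real.sq_sqrt hN0).symm
    ?_ hS (cross a ha p) rfl ?_ ?_ ?_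
  · by_contra hcon
    have hM : dMf a p = 0 := by linarith
    have hN : dNf p = 0 := by linarith
    apply hp
    have h2 := hNz hN
    have h1 := hMz hM
    ext j
    · have := h1 j
      rw [h2 j] at this
      simpa using this
    · exact h2 j
  · rw [← sumA, Finset.mul_sum, Finset.mul_sum, ← Finset.sum_sub_distrib]
    refine le_trans (le_of_eq ?_) (cs _ ξ)
    congr 1
    refine Finset.sum_congr rfl fun j _ => ?_
    ring
  · intro h
    refine Finset.sum_eq_zero fun j _ => ?_
    have : Av a p j = 0 := by
      apply Complex.ext <;> simp [Av, hMz h j]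
    rw [this, zero_mul]
  · intro h
    refine Finset.sum_eq_zero fun j _ => ?_
    have : Bv p j = 0 := by
      apply Complex.ext <;> simp [Bv, hNz h j]
    rw [this, zero_mul]
end

section
/- Let n = 2, a ∈ ℝ with |a| ≤ 2/√5, and set d_M(x,y) = ∑_{j=1}^2 (x_j − a y_j)²/(1+a²), d_N(x,y) = y₁² + y₂². Then ρ = d_M³ d_N + 5 d_M² d_N² + d_M d_N³, viewed as a function on ℂ² ≅ ℝ⁴, is strictly plurisubharmonic at every point of ℂ² ∖ {0}. -/
open Complex

/-- the squared distance to M, with `m = 1/(1+a²)` -/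
noncomputable def fA (a m : ℝ) (p : (Fin 2 → ℝ) × (Fin 2 → ℝ)) : ℝ :=
  m * ((p.1 0 - a * p.2 0) ^ 2 + (p.1 1 - a * p.2 1) ^ 2)

noncomputable def fB (p : (Fin 2 → ℝ) × (Fin 2 → ℝ)) : ℝ := p.2 0 ^ 2 + p.2 1 ^ 2

noncomputable def fU (a : ℝ) (k : Fin 2) (p : (Fin 2 → ℝ) × (Fin 2 → ℝ)) : ℝ :=
  p.1 k - a * p.2 k

noncomputable def dl (j k : Fin 2) : ℝ := if j = k then 1 else 0

lemma coordX (p : (Fin 2 → ℝ) × (Fin 2 → ℝ)) (j k : Fin 2) :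
    HasDerivAt (fun t => Function.update p.1 j t k) (dl j k) (p.1 j) := by
  by_cases h : j = k
  · subst h; simpa [dl] using hasDerivAt_id' (p.1 j)
  · have : (fun t => Function.update p.1 j t k) = fun _ => p.1 k := by
      funext t; simp [Function.update_of_ne (Ne.symm h)]
    rw [this]; simpa [dl, h] using hasDerivAt_const (p.1 j) (p.1 k)

lemma coordY (p : (Fin 2 → ℝ) × (Fin 2 → ℝ)) (j k : Fin 2) :
    HasDerivAt (fun t => Function.update p.2 j t k) (dl j k) (p.2 j) :=
  coordX (p.2, p.1) j k

lemma UX (a : ℝ) (p : (Fin 2 → ℝ) × (Fin 2 → ℝ)) (j k : Fin 2) :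
    HasDerivAt (fun t => fU a k (Function.update p.1 j t, p.2)) (dl j k) (p.1 j) := by
  simpa [fU] using (coordX p j k).sub_const (a * p.2 k)

lemma UY (a : ℝ) (p : (Fin 2 → ℝ) × (Fin 2 → ℝ)) (j k : Fin 2) :
    HasDerivAt (fun t => fU a k (p.1, Function.update p.2 j t)) (-a * dl j k) (p.2 j) := by
  have := ((coordY p j k).const_mul a).const_sub (p.1 k)
  simpa [fU] using this

lemma AX (a m : ℝ) (p : (Fin 2 → ℝ) × (Fin 2 → ℝ)) (j : Fin 2) :
    HasDerivAt (fun t => fA a m (Function.update p.1 j t, p.2)) (2 * m * fU a j p) (p.1 j) := by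
  have := (((UX a p j 0).pow 2).add ((UX a p j 1).pow 2)).const_mul m
  refine HasDerivAt.congr_deriv this ?_
  simp only [Function.update_eq_self]
  fin_cases j <;> simp [dl] <;> ring

lemma AY (a m : ℝ) (p : (Fin 2 → ℝ) × (Fin 2 → ℝ)) (j : Fin 2) :
    HasDerivAt (fun t => fA a m (p.1, Function.update p.2 j t)) (-2 * a * m * fU a j p)
      (p.2 j) := by
  have := (((UY a p j 0).pow 2).add ((UY a p j 1).pow 2)).const_mul m
  refine HasDerivAt.congr_deriv this ?_
  simp only [Function.update_eq_self]
  fin_cases j <;> simp [dl] <;> ring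

lemma BX (p : (Fin 2 → ℝ) × (Fin 2 → ℝ)) (j : Fin 2) :
    HasDerivAt (fun t => fB (Function.update p.1 j t, p.2)) 0 (p.1 j) :=
  hasDerivAt_const (p.1 j) (fB p)

lemma BY (p : (Fin 2 → ℝ) × (Fin 2 → ℝ)) (j : Fin 2) :
    HasDerivAt (fun t => fB (p.1, Function.update p.2 j t)) (2 * p.2 j) (p.2 j) := by
  have := ((coordY p j 0).pow 2).add ((coordY p j 1).pow 2)
  refine HasDerivAt.congr_deriv this ?_
  simp only [Function.update_eq_self]
  fin_cases j <;> simp [dl]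

noncomputable def rho (a m : ℝ) (p : (Fin 2 → ℝ) × (Fin 2 → ℝ)) : ℝ :=
  fA a m p ^ 3 * fB p + 5 * fA a m p ^ 2 * fB p ^ 2 + fA a m p * fB p ^ 3

noncomputable def FA (a m : ℝ) (p : (Fin 2 → ℝ) × (Fin 2 → ℝ)) : ℝ :=
  3 * fA a m p ^ 2 * fB p + 10 * fA a m p * fB p ^ 2 + fB p ^ 3
noncomputable def FB (a m : ℝ) (p : (Fin 2 → ℝ) × (Fin 2 → ℝ)) : ℝ :=
  fA a m p ^ 3 + 10 * fA a m p ^ 2 * fB p + 3 * fA a m p * fB p ^ 2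
noncomputable def FAA (a m : ℝ) (p : (Fin 2 → ℝ) × (Fin 2 → ℝ)) : ℝ :=
  6 * fA a m p * fB p + 10 * fB p ^ 2
noncomputable def FBB (a m : ℝ) (p : (Fin 2 → ℝ) × (Fin 2 → ℝ)) : ℝ :=
  10 * fA a m p ^ 2 + 6 * fA a m p * fB p
noncomputable def FAB (a m : ℝ) (p : (Fin 2 → ℝ) × (Fin 2 → ℝ)) : ℝ :=
  3 * fA a m p ^ 2 + 20 * fA a m p * fB p + 3 * fB p ^ 2

/-- chain rule for the three polynomials in `A`, `B` -/
lemma chain {A B : ℝ → ℝ} {A' B' t : ℝ} (hA : HasDerivAt A A' t) (hB : HasDerivAt B B' t) :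
    HasDerivAt (fun t => A t ^ 3 * B t + 5 * A t ^ 2 * B t ^ 2 + A t * B t ^ 3)
      ((3 * A t ^ 2 * B t + 10 * A t * B t ^ 2 + B t ^ 3) * A' +
        (A t ^ 3 + 10 * A t ^ 2 * B t + 3 * A t * B t ^ 2) * B') t := by
  have := (((hA.pow 3).mul hB).add (((hA.pow 2).const_mul 5).mul (hB.pow 2))).add
    (hA.mul (hB.pow 3))
  refine HasDerivAt.congr_deriv this ?_
  simp; ring

lemma chainA {A B : ℝ → ℝ} {A' B' t : ℝ} (hA : HasDerivAt A A' t) (hB : HasDerivAt B B' t) :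
    HasDerivAt (fun t => 3 * A t ^ 2 * B t + 10 * A t * B t ^ 2 + B t ^ 3)
      ((6 * A t * B t + 10 * B t ^ 2) * A' +
        (3 * A t ^ 2 + 20 * A t * B t + 3 * B t ^ 2) * B') t := by
  have := ((((hA.pow 2).const_mul 3).mul hB).add ((hA.const_mul 10).mul (hB.pow 2))).add
    (hB.pow 3)
  refine HasDerivAt.congr_deriv this ?_
  simp; ring

lemma chainB {A B : ℝ → ℝ} {A' B' t : ℝ} (hA : HasDerivAt A A' t) (hB : HasDerivAt B B' t) :
    HasDerivAt (fun t => A t ^ 3 + 10 * A t ^ 2 * B t + 3 * A t * B t ^ 2)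
      ((3 * A t ^ 2 + 20 * A t * B t + 3 * B t ^ 2) * A' +
        (10 * A t ^ 2 + 6 * A t * B t) * B') t := by
  have := ((hA.pow 3).add (((hA.pow 2).const_mul 10).mul hB)).add
    ((hA.const_mul 3).mul (hB.pow 2))
  refine HasDerivAt.congr_deriv this ?_
  simp; ring

lemma FA_X (a m : ℝ) (p : (Fin 2 → ℝ) × (Fin 2 → ℝ)) (j : Fin 2) :
    HasDerivAt (fun t => FA a m (Function.update p.1 j t, p.2))
      (FAA a m p * (2 * m * fU a j p)) (p.1 j) := by
  have := chainA (AX a m p j) (BX p j)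
  simp only [Function.update_eq_self, mul_zero, add_zero] at this
  exact this

lemma FB_X (a m : ℝ) (p : (Fin 2 → ℝ) × (Fin 2 → ℝ)) (j : Fin 2) :
    HasDerivAt (fun t => FB a m (Function.update p.1 j t, p.2))
      (FAB a m p * (2 * m * fU a j p)) (p.1 j) := by
  have := chainB (AX a m p j) (BX p j)
  simp only [Function.update_eq_self, mul_zero, add_zero] at this
  exact this

lemma FA_Y (a m : ℝ) (p : (Fin 2 → ℝ) × (Fin 2 → ℝ)) (j : Fin 2) :
    HasDerivAt (fun t => FA a m (p.1, Function.update p.2 j t))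
      (FAA a m p * (-2 * a * m * fU a j p) + FAB a m p * (2 * p.2 j)) (p.2 j) := by
  have := chainA (AY a m p j) (BY p j)
  simp only [Function.update_eq_self] at this
  exact this

lemma FB_Y (a m : ℝ) (p : (Fin 2 → ℝ) × (Fin 2 → ℝ)) (j : Fin 2) :
    HasDerivAt (fun t => FB a m (p.1, Function.update p.2 j t))
      (FAB a m p * (-2 * a * m * fU a j p) + FBB a m p * (2 * p.2 j)) (p.2 j) := by
  have := chainB (AY a m p j) (BY p j)
  simp only [Function.update_eq_self] at this
  exact this

lemma rho_X (a m : ℝ) (k : Fin 2) :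
    pderivX k (rho a m) = fun p => FA a m p * (2 * m * fU a k p) := by
  funext p
  have := chain (AX a m p k) (BX p k)
  simp only [Function.update_eq_self, mul_zero, add_zero] at this
  exact this.deriv

lemma rho_Y (a m : ℝ) (k : Fin 2) :
    pderivY k (rho a m) = fun p => FA a m p * (-2 * a * m * fU a k p) +
      FB a m p * (2 * p.2 k) := by
  funext p
  have := chain (AY a m p k) (BY p k)
  simp only [Function.update_eq_self] at this
  exact this.deriv

lemma rho_XX (a m : ℝ) (j k : Fin 2) (p : (Fin 2 → ℝ) × (Fin 2 → ℝ)) :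
    pderivX j (pderivX k (rho a m)) p =
      FAA a m p * (2 * m * fU a j p) * (2 * m * fU a k p) + FA a m p * (2 * m * dl j k) := by
  rw [rho_X]
  have := (FA_X a m p j).mul ((UX a p j k).const_mul (2 * m))
  simp only [Function.update_eq_self] at this
  exact this.deriv

lemma rho_YX (a m : ℝ) (j k : Fin 2) (p : (Fin 2 → ℝ) × (Fin 2 → ℝ)) :
    pderivY j (pderivX k (rho a m)) p =
      (FAA a m p * (-2 * a * m * fU a j p) + FAB a m p * (2 * p.2 j)) * (2 * m * fU a k p)
        + FA a m p * (2 * m * (-a * dl j k)) := by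
  rw [rho_X]
  have := (FA_Y a m p j).mul ((UY a p j k).const_mul (2 * m))
  simp only [Function.update_eq_self] at this
  exact this.deriv

lemma rho_XY (a m : ℝ) (j k : Fin 2) (p : (Fin 2 → ℝ) × (Fin 2 → ℝ)) :
    pderivX j (pderivY k (rho a m)) p =
      (FAA a m p * (2 * m * fU a j p) * (-2 * a * m * fU a k p)
        + FA a m p * (-2 * a * m * dl j k))
      + FAB a m p * (2 * m * fU a j p) * (2 * p.2 k) := by
  rw [rho_Y]
  have := ((FA_X a m p j).mul ((UX a p j k).const_mul (-2 * a * m))).add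
    ((FB_X a m p j).mul_const (2 * p.2 k))
  simp only [Function.update_eq_self] at this
  exact this.deriv

lemma rho_YY (a m : ℝ) (j k : Fin 2) (p : (Fin 2 → ℝ) × (Fin 2 → ℝ)) :
    pderivY j (pderivY k (rho a m)) p =
      ((FAA a m p * (-2 * a * m * fU a j p) + FAB a m p * (2 * p.2 j)) * (-2 * a * m * fU a k p)
        + FA a m p * (-2 * a * m * (-a * dl j k)))
      + ((FAB a m p * (-2 * a * m * fU a j p) + FBB a m p * (2 * p.2 j)) * (2 * p.2 k)
        + FB a m p * (2 * dl j k)) := by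
  rw [rho_Y]
  have := ((FA_Y a m p j).mul ((UY a p j k).const_mul (-2 * a * m))).add
    ((FB_Y a m p j).mul ((coordY p j k).const_mul 2))
  simp only [Function.update_eq_self] at this
  exact this.deriv

noncomputable def RR (a m : ℝ) (j k : Fin 2) (p : (Fin 2 → ℝ) × (Fin 2 → ℝ)) : ℝ :=
  (FA a m p + FB a m p) / 2 * dl j k + FAA a m p * m * fU a j p * fU a k p
    + FBB a m p * p.2 j * p.2 k - a * m * FAB a m p * (fU a j p * p.2 k + p.2 j * fU a k p)

noncomputable def TT (a m : ℝ) (j k : Fin 2) (p : (Fin 2 → ℝ) × (Fin 2 → ℝ)) : ℝ :=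
  m * FAB a m p * (fU a j p * p.2 k - p.2 j * fU a k p)

lemma levi_eq (a m : ℝ) (hm : m * (1 + a ^ 2) = 1) (j k : Fin 2)
    (p : (Fin 2 → ℝ) × (Fin 2 → ℝ)) :
    leviEntry j k (rho a m) p = (RR a m j k p : ℂ) + Complex.I * (TT a m j k p : ℂ) := by
  have h1 : pderivX j (pderivX k (rho a m)) p + pderivY j (pderivY k (rho a m)) p
      = 4 * RR a m j k p := by
    rw [rho_XX, rho_YY, RR]
    linear_combination (4 * FAA a m p * m * fU a j p * fU a k p + 2 * FA a m p * dl j k) * hm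
  have h2 : pderivX j (pderivY k (rho a m)) p - pderivY j (pderivX k (rho a m)) p
      = 4 * TT a m j k p := by
    rw [rho_XY, rho_YX, TT]; ring
  rw [leviEntry, h1, h2]; push_cast; ring

/-- A 2×2 Hermitian form is positive if trace and determinant are. -/
lemma herm_pos (r s b c p1 p2 q1 q2 : ℝ) (htr : 0 < r + s) (hdet : 0 < r * s - b ^ 2 - c ^ 2)
    (h : p1 ≠ 0 ∨ q1 ≠ 0 ∨ p2 ≠ 0 ∨ q2 ≠ 0) :
    0 < r * (p1 ^ 2 + q1 ^ 2) + 2 * b * (p1 * p2 + q1 * q2) + s * (p2 ^ 2 + q2 ^ 2)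
      - 2 * c * (q1 * p2 - p1 * q2) := by
  have hrs : 0 < r * s := by nlinarith [sq_nonneg b, sq_nonneg c]
  have hr : 0 < r := by
    by_contra hn
    have hs : 0 < s := by linarith
    nlinarith
  set Q := r * (p1 ^ 2 + q1 ^ 2) + 2 * b * (p1 * p2 + q1 * q2) + s * (p2 ^ 2 + q2 ^ 2)
      - 2 * c * (q1 * p2 - p1 * q2) with hQ
  have key : r * Q = (r * p1 + b * p2 + c * q2) ^ 2 + (r * q1 + b * q2 - c * p2) ^ 2
      + (r * s - b ^ 2 - c ^ 2) * (p2 ^ 2 + q2 ^ 2) := by rw [hQ]; ring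
  suffices 0 < r * Q from (mul_pos_iff_of_pos_left hr).1 this
  rw [key]
  by_cases h2 : p2 = 0 ∧ q2 = 0
  · obtain ⟨rfl, rfl⟩ := h2
    have : 0 < p1 ^ 2 + q1 ^ 2 := by
      rcases h with h | h | h | h
      · positivity
      · positivity
      · exact absurd rfl h
      · exact absurd rfl h
    have := mul_pos (pow_pos hr 2) this
    nlinarith
  · have : 0 < p2 ^ 2 + q2 ^ 2 := by
      by_cases hp : p2 = 0
      · have : q2 ≠ 0 := fun hq => h2 ⟨hp, hq⟩
        positivity
      · positivity
    have := mul_pos hdet this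
    nlinarith [sq_nonneg (r * p1 + b * p2 + c * q2), sq_nonneg (r * q1 + b * q2 - c * p2)]

/-- The scalar inequality behind the determinant bound. -/
lemma det_pos (a m A B D G F H : ℝ) (hm0 : 0 < m) (hc : 9 * (a ^ 2 * m) ≤ 4)
    (hA : 0 ≤ A) (hB : 0 ≤ B) (hAB : 0 < A + B)
    (hG : G = (A ^ 3 + 13 * A ^ 2 * B + 13 * A * B ^ 2 + B ^ 3) / 2)
    (hF : F = 3 * A ^ 2 + 20 * A * B + 3 * B ^ 2)
    (hH : H = 9 * A ^ 4 + 60 * A ^ 3 * B + 282 * A ^ 2 * B ^ 2 + 60 * A * B ^ 3 + 9 * B ^ 4) :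
    0 < G ^ 2 + G * (16 * A * B * (A + B) - 2 * a * m * F * D) - (A * B - m * D ^ 2) * H := by
  have hH0 : 0 < H := by
    rw [hH]
    rcases hA.lt_or_eq with h | h
    · positivity
    · subst h
      have : 0 < B := by linarith
      positivity
  set P := G ^ 2 + 16 * G * A * B * (A + B) - A * B * H with hP
  have hdisc : 0 < 9 * H * P - 4 * G ^ 2 * F ^ 2 := by
    have e : 9 * H * P - 4 * G ^ 2 * F ^ 2 =
        45 / 4 * (A ^ 10 + B ^ 10) + 453 / 2 * (A ^ 9 * B + A * B ^ 9)
        + 25889 / 4 * (A ^ 8 * B ^ 2 + A ^ 2 * B ^ 8) + 31942 * (A ^ 7 * B ^ 3 + A ^ 3 * B ^ 7)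
        + (145600 + 1 / 2 - 51769 / 2) * (A ^ 6 * B ^ 4 + A ^ 4 * B ^ 6)
        + 51769 / 2 * (A ^ 4 * B ^ 4 * (A - B) ^ 2) := by
      rw [hP, hG, hF, hH]; ring
    rw [e]
    have : 0 < A ^ 10 + B ^ 10 := by
      rcases hA.lt_or_eq with h | h
      · positivity
      · subst h
        have : 0 < B := by linarith
        positivity
    norm_num
    positivity
  have h2 : 9 * (a ^ 2 * m) * (G ^ 2 * F ^ 2) ≤ 4 * (G ^ 2 * F ^ 2) :=
    mul_le_mul_of_nonneg_right hc (by positivity)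
  have h3 : 0 < H * P - a ^ 2 * m * (G ^ 2 * F ^ 2) := by nlinarith
  set X := G ^ 2 + G * (16 * A * B * (A + B) - 2 * a * m * F * D) - (A * B - m * D ^ 2) * H with hX
  have key : H * X = m * (H * D - a * F * G) ^ 2 + (H * P - a ^ 2 * m * (G ^ 2 * F ^ 2)) := by
    rw [hX, hP]; ring
  suffices 0 < H * X from (mul_pos_iff_of_pos_left hH0).1 this
  rw [key]
  positivity

lemma rho_psh (a m : ℝ) (hm : m * (1 + a ^ 2) = 1) (hm0 : 0 < m) (hc : 9 * (a ^ 2 * m) ≤ 4)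
    (p : (Fin 2 → ℝ) × (Fin 2 → ℝ)) (hp : p ≠ 0) : StrictlyPlurisubharmonicAt (rho a m) p := by
  intro ξ hξ
  simp only [Fin.sum_univ_two, levi_eq a m hm]
  have hA : 0 ≤ fA a m p := by unfold fA; positivity
  have hB : 0 ≤ fB p := by unfold fB; positivity
  have hAB : 0 < fA a m p + fB p := by
    by_contra hn
    have hA0 : fA a m p = 0 := by linarith
    have hB0 : fB p = 0 := by linarith
    have y0 : p.2 0 = 0 := by unfold fB at hB0; nlinarith [sq_nonneg (p.2 0), sq_nonneg (p.2 1)]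
    have y1 : p.2 1 = 0 := by unfold fB at hB0; nlinarith [sq_nonneg (p.2 0), sq_nonneg (p.2 1)]
    have hA1 : p.1 0 ^ 2 + p.1 1 ^ 2 = 0 := by
      unfold fA at hA0
      rw [y0, y1] at hA0
      rcases mul_eq_zero.1 hA0 with h | h
      · exact absurd h hm0.ne'
      · simpa using h
    have x0 : p.1 0 = 0 := by nlinarith [sq_nonneg (p.1 0), sq_nonneg (p.1 1)]
    have x1 : p.1 1 = 0 := by nlinarith [sq_nonneg (p.1 0), sq_nonneg (p.1 1)]
    apply hp
    ext i
    · fin_cases i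
      · exact x0
      · exact x1
    · fin_cases i
      · exact y0
      · exact y1
  have hG0 : 0 < (FA a m p + FB a m p) / 2 := by
    have : (FA a m p + FB a m p) / 2 = ((fA a m p + fB p) ^ 3
      + 10 * (fA a m p * fB p) * (fA a m p + fB p)) / 2 := by unfold FA FB; ring
    rw [this]; positivity
  have hE : fA a m p * fB p - m * (fU a 0 p * p.2 0 + fU a 1 p * p.2 1) ^ 2
      = m * (fU a 0 p * p.2 1 - fU a 1 p * p.2 0) ^ 2 := by unfold fA fB fU; ring
  have hAu : fA a m p = m * (fU a 0 p ^ 2 + fU a 1 p ^ 2) := rfl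
  have hBv : fB p = p.2 0 ^ 2 + p.2 1 ^ 2 := rfl
  have hdet0 := det_pos a m (fA a m p) (fB p) (fU a 0 p * p.2 0 + fU a 1 p * p.2 1)
    ((FA a m p + FB a m p) / 2) (FAB a m p) _ hm0 hc hA hB hAB
    (by unfold FA FB; ring) rfl rfl
  rw [hE] at hdet0
  have hHF : 9 * fA a m p ^ 4 + 60 * fA a m p ^ 3 * fB p + 282 * fA a m p ^ 2 * fB p ^ 2
      + 60 * fA a m p * fB p ^ 3 + 9 * fB p ^ 4 = FAB a m p ^ 2 - FAA a m p * FBB a m p := by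
    unfold FAB FAA FBB; ring
  have hH0 : 0 ≤ FAB a m p ^ 2 - FAA a m p * FBB a m p := by rw [← hHF]; positivity
  rw [hHF] at hdet0
  have h16 : 16 * fA a m p * fB p * (fA a m p + fB p)
      = FAA a m p * fA a m p + FBB a m p * fB p := by unfold FAA FBB; ring
  rw [h16] at hdet0
  have htr : RR a m 0 0 p + RR a m 1 1 p = 2 * ((FA a m p + FB a m p) / 2)
      + (FAA a m p * fA a m p + FBB a m p * fB p
        - 2 * a * m * FAB a m p * (fU a 0 p * p.2 0 + fU a 1 p * p.2 1)) := by
    rw [hAu, hBv]; simp only [RR, dl, if_true]; ring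
  have hdt : RR a m 0 0 p * RR a m 1 1 p - RR a m 0 1 p ^ 2 - TT a m 0 1 p ^ 2 =
      ((FA a m p + FB a m p) / 2) ^ 2 + (FA a m p + FB a m p) / 2 *
        (FAA a m p * fA a m p + FBB a m p * fB p
        - 2 * a * m * FAB a m p * (fU a 0 p * p.2 0 + fU a 1 p * p.2 1))
      - m * (fU a 0 p * p.2 1 - fU a 1 p * p.2 0) ^ 2
        * (FAB a m p ^ 2 - FAA a m p * FBB a m p) := by
    have d01 : dl 0 1 = 0 := by simp [dl]
    have d00 : dl 0 0 = 1 := by simp [dl]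
    have d11 : dl 1 1 = 1 := by simp [dl]
    rw [hAu, hBv]; simp only [RR, TT, d01, d00, d11]
    linear_combination (-m * FAB a m p ^ 2 * (fU a 0 p * p.2 1 - fU a 1 p * p.2 0) ^ 2) * hm
  rw [← hdt] at hdet0
  have htr0 : 0 < RR a m 0 0 p + RR a m 1 1 p := by
    rw [htr]
    rw [hdt] at hdet0
    generalize (FA a m p + FB a m p) / 2 = G at *
    generalize FAA a m p * fA a m p + FBB a m p * fB p
        - 2 * a * m * FAB a m p * (fU a 0 p * p.2 0 + fU a 1 p * p.2 1) = K at *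
    have : 0 ≤ m * (fU a 0 p * p.2 1 - fU a 1 p * p.2 0) ^ 2
        * (FAB a m p ^ 2 - FAA a m p * FBB a m p) := by positivity
    have h : 0 < G * (G + K) := by nlinarith
    have := (mul_pos_iff_of_pos_left hG0).1 h
    linarith
  have hne : (ξ 0).re ≠ 0 ∨ (ξ 0).im ≠ 0 ∨ (ξ 1).re ≠ 0 ∨ (ξ 1).im ≠ 0 := by
    by_contra hn
    push Not at hn
    apply hξ
    funext i
    fin_cases i
    · exact Complex.ext hn.1 hn.2.1
    · exact Complex.ext hn.2.2.1 hn.2.2.2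
  have hfin := herm_pos _ _ _ _ (ξ 0).re (ξ 1).re (ξ 0).im (ξ 1).im htr0 hdet0 hne
  have hsR : RR a m 1 0 p = RR a m 0 1 p := by
    simp only [RR, dl]; simp; ring
  have hsT : TT a m 1 0 p = - TT a m 0 1 p := by
    simp only [TT]; ring
  have h00 : TT a m 0 0 p = 0 := by simp only [TT]; ring
  have h11 : TT a m 1 1 p = 0 := by simp only [TT]; ring
  rw [hsR, hsT, h00, h11]
  convert hfin using 1
  simp
  ring

/-- For `n = 2`, `M = (aI + iI)ℝ²` with `|a| ≤ 2/√5`, the function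
`ρ = d_M³ d_N + 5 d_M² d_N² + d_M d_N³` is strictly plurisubharmonic on `ℂ² ∖ {0}`. -/
theorem psh_cubic_of_small_a (a : ℝ) (ha : |a| ≤ 2 / Real.sqrt 5) :
    let dM : (Fin 2 → ℝ) × (Fin 2 → ℝ) → ℝ :=
      fun p => ∑ j, (p.1 j - a * p.2 j) ^ 2 / (1 + a ^ 2)
    let dN : (Fin 2 → ℝ) × (Fin 2 → ℝ) → ℝ := fun p => ∑ j, (p.2 j) ^ 2
    let ρ : (Fin 2 → ℝ) × (Fin 2 → ℝ) → ℝ :=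
      fun p => (dM p) ^ 3 * dN p + 5 * (dM p) ^ 2 * (dN p) ^ 2 + dM p * (dN p) ^ 3
    ∀ p : (Fin 2 → ℝ) × (Fin 2 → ℝ), p ≠ 0 → StrictlyPlurisubharmonicAt ρ p := by
  intro dM dN ρ p hp
  have h1 : (0 : ℝ) < 1 + a ^ 2 := by positivity
  have ha2 : a ^ 2 ≤ 4 / 5 := by
    have h5 : (0 : ℝ) ≤ 2 / Real.sqrt 5 := by positivity
    have := pow_le_pow_left₀ (abs_nonneg a) ha 2
    rw [sq_abs, div_pow, Real.sq_sqrt (by norm_num)] at this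
    linarith
  have hρ : ρ = rho a (1 + a ^ 2)⁻¹ := by
    funext q
    simp only [ρ, dM, dN, rho, fA, fB, Fin.sum_univ_two]
    ring
  rw [hρ]
  refine rho_psh a _ (inv_mul_cancel₀ h1.ne') (inv_pos.2 h1) ?_ p hp
  rw [← div_eq_mul_inv, ← mul_div_assoc, div_le_iff₀ h1]
  linarith
end

section
/- Let n = 2, b, c ∈ ℝ with |b|, |c| ≤ 1/16, and set d_M(x₁,x₂,y₁,y₂) = [(x₁ − c y₁ + b y₂)² + (x₂ − c y₂ − b y₁)²]/(1+b²+c²), d_N = y₁² + y₂². Then ρ = d_M² d_N + d_M d_N², viewed as a function on ℂ² ≅ ℝ⁴, is strictly plurisubharmonic at every point of ℂ² ∖ {0}. -/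
open Complex

set_option maxHeartbeats 4000000

namespace PshBlock

/-- The model function in the coordinates `w = x - A y` and `y`. -/
def G0 (K s w1 w2 y1 y2 : ℝ) : ℝ :=
  K * ((w1^2+w2^2)^2*(y1^2+y2^2) + s*(w1^2+w2^2)*(y1^2+y2^2)^2)

/-- First directional derivative of `G0`. -/
def G1 (K s w1 w2 y1 y2 o1 o2 e1 e2 : ℝ) : ℝ :=
  K * ((2*(w1^2+w2^2)*(y1^2+y2^2) + s*(y1^2+y2^2)^2)*(2*(w1*o1+w2*o2))
    + ((w1^2+w2^2)^2 + 2*s*(w1^2+w2^2)*(y1^2+y2^2))*(2*(y1*e1+y2*e2)))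

/-- Second directional derivative of `G0`. -/
def G2 (K s w1 w2 y1 y2 o1 o2 e1 e2 q1 q2 f1 f2 : ℝ) : ℝ :=
  K * ((2*(w1^2+w2^2)*(y1^2+y2^2) + s*(y1^2+y2^2)^2)*(2*(q1*o1+q2*o2))
    + ((w1^2+w2^2)^2 + 2*s*(w1^2+w2^2)*(y1^2+y2^2))*(2*(f1*e1+f2*e2))
    + 4*(2*(y1^2+y2^2)*(w1*o1+w2*o2)*(w1*q1+w2*q2)
      + (2*(w1^2+w2^2)+2*s*(y1^2+y2^2))*((w1*o1+w2*o2)*(y1*f1+y2*f2)+(w1*q1+w2*q2)*(y1*e1+y2*e2))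
      + 2*s*(w1^2+w2^2)*(y1*e1+y2*e2)*(y1*f1+y2*f2)))

lemma G0_deriv (K s : ℝ) {w1 w2 y1 y2 : ℝ → ℝ} {q1 q2 f1 f2 t : ℝ}
    (h1 : HasDerivAt w1 q1 t) (h2 : HasDerivAt w2 q2 t)
    (h3 : HasDerivAt y1 f1 t) (h4 : HasDerivAt y2 f2 t) :
    HasDerivAt (fun t => G0 K s (w1 t) (w2 t) (y1 t) (y2 t))
      (G1 K s (w1 t) (w2 t) (y1 t) (y2 t) q1 q2 f1 f2) t := by
  have hm := (h1.fun_pow 2).fun_add (h2.fun_pow 2)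
  have hn := (h3.fun_pow 2).fun_add (h4.fun_pow 2)
  have h := (((hm.fun_pow 2).fun_mul hn).fun_add ((hm.const_mul s).fun_mul (hn.fun_pow 2))).const_mul K
  unfold G0 G1
  refine h.congr_deriv ?_
  push_cast
  ring

lemma G1_deriv (K s o1 o2 e1 e2 : ℝ) {w1 w2 y1 y2 : ℝ → ℝ} {q1 q2 f1 f2 t : ℝ}
    (h1 : HasDerivAt w1 q1 t) (h2 : HasDerivAt w2 q2 t)
    (h3 : HasDerivAt y1 f1 t) (h4 : HasDerivAt y2 f2 t) :
    HasDerivAt (fun t => G1 K s (w1 t) (w2 t) (y1 t) (y2 t) o1 o2 e1 e2)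
      (G2 K s (w1 t) (w2 t) (y1 t) (y2 t) o1 o2 e1 e2 q1 q2 f1 f2) t := by
  have hm := (h1.fun_pow 2).fun_add (h2.fun_pow 2)
  have hn := (h3.fun_pow 2).fun_add (h4.fun_pow 2)
  have ho := ((h1.mul_const o1).fun_add (h2.mul_const o2)).const_mul 2
  have he := ((h3.mul_const e1).fun_add (h4.mul_const e2)).const_mul 2
  have h := ((((hm.const_mul 2).fun_mul hn).fun_add ((hn.fun_pow 2).const_mul s)).fun_mul ho).fun_add
    (((hm.fun_pow 2).fun_add ((hm.const_mul (2*s)).fun_mul hn)).fun_mul he)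
  have h' := h.const_mul K
  unfold G1 G2
  refine h'.congr_deriv ?_
  push_cast
  ring

lemma dX0_G0 (K s b c : ℝ) :
    pderivX 0 (fun p : (Fin 2 → ℝ) × (Fin 2 → ℝ) => G0 K s (p.1 0 - c * p.2 0 + b * p.2 1) (p.1 1 - c * p.2 1 - b * p.2 0) (p.2 0) (p.2 1))
    = fun p => G1 K s (p.1 0 - c * p.2 0 + b * p.2 1) (p.1 1 - c * p.2 1 - b * p.2 0) (p.2 0) (p.2 1) 1 0 0 0 := by
  funext p
  have h1 : HasDerivAt (fun t : ℝ => t - c * (p.2 0) + b * (p.2 1)) 1 (p.1 0) := by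
    refine HasDerivAt.congr_deriv (HasDerivAt.fun_add (HasDerivAt.fun_sub (hasDerivAt_id' _) (HasDerivAt.const_mul c (hasDerivAt_const _ (p.2 0)))) (HasDerivAt.const_mul b (hasDerivAt_const _ (p.2 1)))) ?_
    ring
  have h2 : HasDerivAt (fun t : ℝ => (p.1 1) - c * (p.2 1) - b * (p.2 0)) 0 (p.1 0) := by
    refine HasDerivAt.congr_deriv (HasDerivAt.fun_sub (HasDerivAt.fun_sub (hasDerivAt_const _ (p.1 1)) (HasDerivAt.const_mul c (hasDerivAt_const _ (p.2 1)))) (HasDerivAt.const_mul b (hasDerivAt_const _ (p.2 0)))) ?_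
    ring
  have h := (G0_deriv K s h1 h2 (hasDerivAt_const _ (p.2 0)) (hasDerivAt_const _ (p.2 1))).deriv
  simpa [pderivX, Function.update] using h

lemma dX0_G1 (K s b c o1 o2 e1 e2 : ℝ) :
    pderivX 0 (fun p : (Fin 2 → ℝ) × (Fin 2 → ℝ) => G1 K s (p.1 0 - c * p.2 0 + b * p.2 1) (p.1 1 - c * p.2 1 - b * p.2 0) (p.2 0) (p.2 1) o1 o2 e1 e2)
    = fun p => G2 K s (p.1 0 - c * p.2 0 + b * p.2 1) (p.1 1 - c * p.2 1 - b * p.2 0) (p.2 0) (p.2 1) o1 o2 e1 e2 1 0 0 0 := by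
  funext p
  have h1 : HasDerivAt (fun t : ℝ => t - c * (p.2 0) + b * (p.2 1)) 1 (p.1 0) := by
    refine HasDerivAt.congr_deriv (HasDerivAt.fun_add (HasDerivAt.fun_sub (hasDerivAt_id' _) (HasDerivAt.const_mul c (hasDerivAt_const _ (p.2 0)))) (HasDerivAt.const_mul b (hasDerivAt_const _ (p.2 1)))) ?_
    ring
  have h2 : HasDerivAt (fun t : ℝ => (p.1 1) - c * (p.2 1) - b * (p.2 0)) 0 (p.1 0) := by
    refine HasDerivAt.congr_deriv (HasDerivAt.fun_sub (HasDerivAt.fun_sub (hasDerivAt_const _ (p.1 1)) (HasDerivAt.const_mul c (hasDerivAt_const _ (p.2 1)))) (HasDerivAt.const_mul b (hasDerivAt_const _ (p.2 0)))) ?_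
    ring
  have h := (G1_deriv K s o1 o2 e1 e2 h1 h2 (hasDerivAt_const _ (p.2 0)) (hasDerivAt_const _ (p.2 1))).deriv
  simpa [pderivX, Function.update] using h

lemma dX1_G0 (K s b c : ℝ) :
    pderivX 1 (fun p : (Fin 2 → ℝ) × (Fin 2 → ℝ) => G0 K s (p.1 0 - c * p.2 0 + b * p.2 1) (p.1 1 - c * p.2 1 - b * p.2 0) (p.2 0) (p.2 1))
    = fun p => G1 K s (p.1 0 - c * p.2 0 + b * p.2 1) (p.1 1 - c * p.2 1 - b * p.2 0) (p.2 0) (p.2 1) 0 1 0 0 := by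
  funext p
  have h1 : HasDerivAt (fun t : ℝ => (p.1 0) - c * (p.2 0) + b * (p.2 1)) 0 (p.1 1) := by
    refine HasDerivAt.congr_deriv (HasDerivAt.fun_add (HasDerivAt.fun_sub (hasDerivAt_const _ (p.1 0)) (HasDerivAt.const_mul c (hasDerivAt_const _ (p.2 0)))) (HasDerivAt.const_mul b (hasDerivAt_const _ (p.2 1)))) ?_
    ring
  have h2 : HasDerivAt (fun t : ℝ => t - c * (p.2 1) - b * (p.2 0)) 1 (p.1 1) := by
    refine HasDerivAt.congr_deriv (HasDerivAt.fun_sub (HasDerivAt.fun_sub (hasDerivAt_id' _) (HasDerivAt.const_mul c (hasDerivAt_const _ (p.2 1)))) (HasDerivAt.const_mul b (hasDerivAt_const _ (p.2 0)))) ?_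
    ring
  have h := (G0_deriv K s h1 h2 (hasDerivAt_const _ (p.2 0)) (hasDerivAt_const _ (p.2 1))).deriv
  simpa [pderivX, Function.update] using h

lemma dX1_G1 (K s b c o1 o2 e1 e2 : ℝ) :
    pderivX 1 (fun p : (Fin 2 → ℝ) × (Fin 2 → ℝ) => G1 K s (p.1 0 - c * p.2 0 + b * p.2 1) (p.1 1 - c * p.2 1 - b * p.2 0) (p.2 0) (p.2 1) o1 o2 e1 e2)
    = fun p => G2 K s (p.1 0 - c * p.2 0 + b * p.2 1) (p.1 1 - c * p.2 1 - b * p.2 0) (p.2 0) (p.2 1) o1 o2 e1 e2 0 1 0 0 := by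
  funext p
  have h1 : HasDerivAt (fun t : ℝ => (p.1 0) - c * (p.2 0) + b * (p.2 1)) 0 (p.1 1) := by
    refine HasDerivAt.congr_deriv (HasDerivAt.fun_add (HasDerivAt.fun_sub (hasDerivAt_const _ (p.1 0)) (HasDerivAt.const_mul c (hasDerivAt_const _ (p.2 0)))) (HasDerivAt.const_mul b (hasDerivAt_const _ (p.2 1)))) ?_
    ring
  have h2 : HasDerivAt (fun t : ℝ => t - c * (p.2 1) - b * (p.2 0)) 1 (p.1 1) := by
    refine HasDerivAt.congr_deriv (HasDerivAt.fun_sub (HasDerivAt.fun_sub (hasDerivAt_id' _) (HasDerivAt.const_mul c (hasDerivAt_const _ (p.2 1)))) (HasDerivAt.const_mul b (hasDerivAt_const _ (p.2 0)))) ?_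
    ring
  have h := (G1_deriv K s o1 o2 e1 e2 h1 h2 (hasDerivAt_const _ (p.2 0)) (hasDerivAt_const _ (p.2 1))).deriv
  simpa [pderivX, Function.update] using h

lemma dY0_G0 (K s b c : ℝ) :
    pderivY 0 (fun p : (Fin 2 → ℝ) × (Fin 2 → ℝ) => G0 K s (p.1 0 - c * p.2 0 + b * p.2 1) (p.1 1 - c * p.2 1 - b * p.2 0) (p.2 0) (p.2 1))
    = fun p => G1 K s (p.1 0 - c * p.2 0 + b * p.2 1) (p.1 1 - c * p.2 1 - b * p.2 0) (p.2 0) (p.2 1) (-c) (-b) 1 0 := by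
  funext p
  have h1 : HasDerivAt (fun t : ℝ => (p.1 0) - c * t + b * (p.2 1)) (-c) (p.2 0) := by
    refine HasDerivAt.congr_deriv (HasDerivAt.fun_add (HasDerivAt.fun_sub (hasDerivAt_const _ (p.1 0)) (HasDerivAt.const_mul c (hasDerivAt_id' _))) (HasDerivAt.const_mul b (hasDerivAt_const _ (p.2 1)))) ?_
    ring
  have h2 : HasDerivAt (fun t : ℝ => (p.1 1) - c * (p.2 1) - b * t) (-b) (p.2 0) := by
    refine HasDerivAt.congr_deriv (HasDerivAt.fun_sub (HasDerivAt.fun_sub (hasDerivAt_const _ (p.1 1)) (HasDerivAt.const_mul c (hasDerivAt_const _ (p.2 1)))) (HasDerivAt.const_mul b (hasDerivAt_id' _))) ?_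
    ring
  have h := (G0_deriv K s h1 h2 (hasDerivAt_id' _) (hasDerivAt_const _ (p.2 1))).deriv
  simpa [pderivY, Function.update] using h

lemma dY0_G1 (K s b c o1 o2 e1 e2 : ℝ) :
    pderivY 0 (fun p : (Fin 2 → ℝ) × (Fin 2 → ℝ) => G1 K s (p.1 0 - c * p.2 0 + b * p.2 1) (p.1 1 - c * p.2 1 - b * p.2 0) (p.2 0) (p.2 1) o1 o2 e1 e2)
    = fun p => G2 K s (p.1 0 - c * p.2 0 + b * p.2 1) (p.1 1 - c * p.2 1 - b * p.2 0) (p.2 0) (p.2 1) o1 o2 e1 e2 (-c) (-b) 1 0 := by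
  funext p
  have h1 : HasDerivAt (fun t : ℝ => (p.1 0) - c * t + b * (p.2 1)) (-c) (p.2 0) := by
    refine HasDerivAt.congr_deriv (HasDerivAt.fun_add (HasDerivAt.fun_sub (hasDerivAt_const _ (p.1 0)) (HasDerivAt.const_mul c (hasDerivAt_id' _))) (HasDerivAt.const_mul b (hasDerivAt_const _ (p.2 1)))) ?_
    ring
  have h2 : HasDerivAt (fun t : ℝ => (p.1 1) - c * (p.2 1) - b * t) (-b) (p.2 0) := by
    refine HasDerivAt.congr_deriv (HasDerivAt.fun_sub (HasDerivAt.fun_sub (hasDerivAt_const _ (p.1 1)) (HasDerivAt.const_mul c (hasDerivAt_const _ (p.2 1)))) (HasDerivAt.const_mul b (hasDerivAt_id' _))) ?_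
    ring
  have h := (G1_deriv K s o1 o2 e1 e2 h1 h2 (hasDerivAt_id' _) (hasDerivAt_const _ (p.2 1))).deriv
  simpa [pderivY, Function.update] using h

lemma dY1_G0 (K s b c : ℝ) :
    pderivY 1 (fun p : (Fin 2 → ℝ) × (Fin 2 → ℝ) => G0 K s (p.1 0 - c * p.2 0 + b * p.2 1) (p.1 1 - c * p.2 1 - b * p.2 0) (p.2 0) (p.2 1))
    = fun p => G1 K s (p.1 0 - c * p.2 0 + b * p.2 1) (p.1 1 - c * p.2 1 - b * p.2 0) (p.2 0) (p.2 1) b (-c) 0 1 := by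
  funext p
  have h1 : HasDerivAt (fun t : ℝ => (p.1 0) - c * (p.2 0) + b * t) b (p.2 1) := by
    refine HasDerivAt.congr_deriv (HasDerivAt.fun_add (HasDerivAt.fun_sub (hasDerivAt_const _ (p.1 0)) (HasDerivAt.const_mul c (hasDerivAt_const _ (p.2 0)))) (HasDerivAt.const_mul b (hasDerivAt_id' _))) ?_
    ring
  have h2 : HasDerivAt (fun t : ℝ => (p.1 1) - c * t - b * (p.2 0)) (-c) (p.2 1) := by
    refine HasDerivAt.congr_deriv (HasDerivAt.fun_sub (HasDerivAt.fun_sub (hasDerivAt_const _ (p.1 1)) (HasDerivAt.const_mul c (hasDerivAt_id' _))) (HasDerivAt.const_mul b (hasDerivAt_const _ (p.2 0)))) ?_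
    ring
  have h := (G0_deriv K s h1 h2 (hasDerivAt_const _ (p.2 0)) (hasDerivAt_id' _)).deriv
  simpa [pderivY, Function.update] using h

lemma dY1_G1 (K s b c o1 o2 e1 e2 : ℝ) :
    pderivY 1 (fun p : (Fin 2 → ℝ) × (Fin 2 → ℝ) => G1 K s (p.1 0 - c * p.2 0 + b * p.2 1) (p.1 1 - c * p.2 1 - b * p.2 0) (p.2 0) (p.2 1) o1 o2 e1 e2)
    = fun p => G2 K s (p.1 0 - c * p.2 0 + b * p.2 1) (p.1 1 - c * p.2 1 - b * p.2 0) (p.2 0) (p.2 1) o1 o2 e1 e2 b (-c) 0 1 := by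
  funext p
  have h1 : HasDerivAt (fun t : ℝ => (p.1 0) - c * (p.2 0) + b * t) b (p.2 1) := by
    refine HasDerivAt.congr_deriv (HasDerivAt.fun_add (HasDerivAt.fun_sub (hasDerivAt_const _ (p.1 0)) (HasDerivAt.const_mul c (hasDerivAt_const _ (p.2 0)))) (HasDerivAt.const_mul b (hasDerivAt_id' _))) ?_
    ring
  have h2 : HasDerivAt (fun t : ℝ => (p.1 1) - c * t - b * (p.2 0)) (-c) (p.2 1) := by
    refine HasDerivAt.congr_deriv (HasDerivAt.fun_sub (HasDerivAt.fun_sub (hasDerivAt_const _ (p.1 1)) (HasDerivAt.const_mul c (hasDerivAt_id' _))) (HasDerivAt.const_mul b (hasDerivAt_const _ (p.2 0)))) ?_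
    ring
  have h := (G1_deriv K s o1 o2 e1 e2 h1 h2 (hasDerivAt_const _ (p.2 0)) (hasDerivAt_id' _)).deriv
  simpa [pderivY, Function.update] using h

lemma core (x y t : ℝ) (ht : 0 < t) :
    ((t^2+2*(x^2+y^2))/8+4*t*y)^2
      + (x^2+y^2)*((257/64*x+y/64+t/4)^2+((x+y)/64+t/4)^2)
    < (t^2+6*(x^2+y^2)-t*(x+y)/4)^2 := by
  have h : (t^2+6*(x^2+y^2)-t*(x+y)/4)^2 - (((t^2+2*(x^2+y^2))/8+4*t*y)^2
      + (x^2+y^2)*((257/64*x+y/64+t/4)^2+((x+y)/64+t/4)^2))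
      = (1/100)*t^4 + ((1559/1600)*((1)*(t^2) + (-1200/1559)*(t*y) + (-5925/1559)*(y^2) + (-400/1559)*(t*x) + (625/3118)*(x*y) + (-25/1559)*(x^2))^2 + (134895/49888)*((1)*(t*y) + (-356413/179860)*(y^2) + (-64903/539580)*(t*x) + (-27621/35972)*(x*y) + (66557/107916)*(x^2))^2 + (1035566343/92088320)*((1)*(y^2) + (-172747124/1035566343)*(t*x) + (-105440435/345188781)*(x*y) + (-74582345/1035566343)*(x^2))^2 + (6092144558093/530209967616)*((1)*(t*x) + (-2629909286436/6092144558093)*(x*y) + (-1297069035412/6092144558093)*(x^2))^2 + (736569321838377749/12476712054974464)*((1)*(x*y) + (-1032957107562448/736569321838377749)*(x^2))^2 + (2574425630703185855959/141421309792968527808)*((1)*(x^2))^2) := by ring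
  have h2 : 0 < (1/100)*t^4 + ((1559/1600)*((1)*(t^2) + (-1200/1559)*(t*y) + (-5925/1559)*(y^2) + (-400/1559)*(t*x) + (625/3118)*(x*y) + (-25/1559)*(x^2))^2 + (134895/49888)*((1)*(t*y) + (-356413/179860)*(y^2) + (-64903/539580)*(t*x) + (-27621/35972)*(x*y) + (66557/107916)*(x^2))^2 + (1035566343/92088320)*((1)*(y^2) + (-172747124/1035566343)*(t*x) + (-105440435/345188781)*(x*y) + (-74582345/1035566343)*(x^2))^2 + (6092144558093/530209967616)*((1)*(t*x) + (-2629909286436/6092144558093)*(x*y) + (-1297069035412/6092144558093)*(x^2))^2 + (736569321838377749/12476712054974464)*((1)*(x*y) + (-1032957107562448/736569321838377749)*(x^2))^2 + (2574425630703185855959/141421309792968527808)*((1)*(x^2))^2) := by positivity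
  linarith

lemma abs_mul_le {u v C : ℝ} (hu : |u| ≤ C) : |u * v| ≤ C * |v| := by
  rw [abs_mul]; exact mul_le_mul_of_nonneg_right hu (abs_nonneg v)

/-- The key determinant estimate. -/
lemma det_pos (b c m n h1 h2 s T : ℝ) (hb : |b| ≤ 1/16) (hc : |c| ≤ 1/16)
    (hm : 0 ≤ m) (hn : 0 ≤ n) (hmn : h1^2 + h2^2 = m*n) (hs : s = 1 + b^2 + c^2)
    (hT : T = m + s*n) (hpos : 0 < m + n) :
    0 < T^2 + 6*s*m*n - 4*T*c*h1 + 4*T*b*h2 ∧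
    (2*b*(4*m*n+s*n^2) + 4*T*h2)^2
      + m*n*(((4+4*c^2)*h1 - 4*b*c*h2 - 4*c*T)^2 + (4*b*c*h1 - 4*b^2*h2 - 4*b*T)^2)
    < (T^2 + 6*s*m*n - 4*T*c*h1 + 4*T*b*h2)^2 := by
  have hs1 : 1 ≤ s := by rw [hs]; nlinarith [sq_nonneg b, sq_nonneg c]
  have hsn : n ≤ s * n := by nlinarith
  have hT0 : 0 < T := by rw [hT]; linarith
  have hmn0 : 0 ≤ m * n := mul_nonneg hm hn
  set x := |h1| with hx
  set y := |h2| with hy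
  have hx0 : 0 ≤ x := abs_nonneg _
  have hy0 : 0 ≤ y := abs_nonneg _
  have hxy : x^2 + y^2 = m*n := by rw [hx, hy, sq_abs, sq_abs, hmn]
  have hb2 : b^2 ≤ 1/256 := by
    have := sq_le_sq' (by linarith [neg_abs_le b, abs_nonneg b]) hb
    rw [sq_abs] at this; linarith
  have hc2 : c^2 ≤ 1/256 := by
    have := sq_le_sq' (by linarith [neg_abs_le c, abs_nonneg c]) hc
    rw [sq_abs] at this; linarith
  have hbc : |b*c| ≤ 1/256 := by
    rw [abs_mul]; nlinarith [abs_nonneg b, abs_nonneg c]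
  have hch1 := abs_le.1 (abs_mul_le (v := h1) hc)
  have hbh2 := abs_le.1 (abs_mul_le (v := h2) hb)
  have hbch1 := abs_le.1 (abs_mul_le (v := h1) hbc)
  have hbch2 := abs_le.1 (abs_mul_le (v := h2) hbc)
  have hb2' : |b^2| ≤ 1/256 := by rw [abs_of_nonneg (sq_nonneg b)]; exact hb2
  have hc2' : |c^2| ≤ 1/256 := by rw [abs_of_nonneg (sq_nonneg c)]; exact hc2
  have hb2h2 := abs_le.1 (abs_mul_le (v := h2) hb2')
  have hc2h1 := abs_le.1 (abs_mul_le (v := h1) hc2')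
  have hcT := abs_le.1 (abs_mul_le (v := T) hc)
  have hbT := abs_le.1 (abs_mul_le (v := T) hb)
  rw [abs_of_pos hT0] at hcT hbT
  rw [← hx] at hch1 hbch1 hc2h1
  rw [← hy] at hbh2 hbch2 hb2h2
  have hh1 := abs_le.1 (le_of_eq hx.symm)
  have hh2 := abs_le.1 (le_of_eq hy.symm)
  have hP : T^2+6*(x^2+y^2)-T*(x+y)/4 ≤ T^2 + 6*s*m*n - 4*T*c*h1 + 4*T*b*h2 := by
    have e1 : 0 ≤ T * (x/16 - c*h1) := mul_nonneg hT0.le (by linarith)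
    have e2 : 0 ≤ T * (y/16 + b*h2) := mul_nonneg hT0.le (by linarith)
    have e3 : 0 ≤ (s-1)*(m*n) := mul_nonneg (by linarith) hmn0
    rw [hxy]; linarith
  have hp0 : 0 < T^2+6*(x^2+y^2)-T*(x+y)/4 := by
    linarith [sq_nonneg (T - x), sq_nonneg (T-y), sq_pos_of_pos hT0, sq_nonneg x, sq_nonneg y]
  have hK0 : 0 ≤ 4*m*n+s*n^2 := by
    have := mul_nonneg (by linarith : 0 ≤ s) (sq_nonneg n)
    linarith
  have hK : 4*m*n+s*n^2 ≤ T^2+2*(x^2+y^2) := by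
    rw [hxy, hT]
    linarith [sq_nonneg m, mul_nonneg (sub_nonneg.2 hs1) hmn0, mul_nonneg (mul_nonneg (sub_nonneg.2 hs1) (by linarith : 0 ≤ s)) (sq_nonneg n)]
  have hbK := abs_le.1 (abs_mul_le (v := 4*m*n+s*n^2) hb)
  rw [abs_of_nonneg hK0] at hbK
  have hTh2a : T*h2 ≤ T*y := mul_le_mul_of_nonneg_left hh2.2 hT0.le
  have hTh2b : -(T*y) ≤ T*h2 := by linarith [mul_le_mul_of_nonneg_left hh2.1 hT0.le]
  have hQ : (2*b*(4*m*n+s*n^2) + 4*T*h2)^2 ≤ ((T^2+2*(x^2+y^2))/8+4*T*y)^2 :=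
    sq_le_sq' (by linarith) (by linarith)
  have hI1 : ((4+4*c^2)*h1 - 4*b*c*h2 - 4*c*T)^2 ≤ (257/64*x+y/64+T/4)^2 :=
    sq_le_sq' (by linarith) (by linarith)
  have hI2 : (4*b*c*h1 - 4*b^2*h2 - 4*b*T)^2 ≤ ((x+y)/64+T/4)^2 :=
    sq_le_sq' (by linarith) (by linarith)
  have hI := mul_le_mul_of_nonneg_left (add_le_add hI1 hI2) hmn0
  have hc0 := core x y T hT0
  have hPP := pow_le_pow_left₀ hp0.le hP 2
  rw [hxy] at hc0 hPP hQ
  exact ⟨lt_of_lt_of_le hp0 hP, by linarith⟩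

/-- A Hermitian form with positive determinant and trace is positive. -/
lemma herm_pos (P D Z1 Z2 u1 u2 v1 v2 : ℝ) (hP : 0 < P) (hdet : D^2 + (Z1^2+Z2^2) < P^2)
    (hne : 0 < u1^2+u2^2+v1^2+v2^2) :
    0 < (P - D)*(u1^2+u2^2) + (P + D)*(v1^2+v2^2)
      + 2*(Z1*(u1*v1+u2*v2) - Z2*(u2*v1-u1*v2)) := by
  have hU : 0 < P - D := by nlinarith [sq_nonneg Z1, sq_nonneg Z2]
  have hV : 0 < P + D := by nlinarith [sq_nonneg Z1, sq_nonneg Z2]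
  have key : (P - D) * ((P - D)*(u1^2+u2^2) + (P + D)*(v1^2+v2^2)
      + 2*(Z1*(u1*v1+u2*v2) - Z2*(u2*v1-u1*v2)))
      = ((P-D)*u1 + Z1*v1 + Z2*v2)^2 + ((P-D)*u2 + Z1*v2 - Z2*v1)^2
        + (P^2 - D^2 - (Z1^2+Z2^2))*(v1^2+v2^2) := by ring
  refine pos_of_mul_pos_right (a := P - D) ?_ hU.le
  rw [key]
  by_cases hv : v1^2+v2^2 = 0
  · have h1 : v1 = 0 := by nlinarith [sq_nonneg v1, sq_nonneg v2]
    have h2 : v2 = 0 := by nlinarith [sq_nonneg v1, sq_nonneg v2]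
    subst h1 h2
    have : 0 < (P-D)^2*(u1^2+u2^2) := mul_pos (pow_pos hU 2) (by linarith)
    nlinarith
  · have : 0 < v1^2+v2^2 := lt_of_le_of_ne (by positivity) (Ne.symm hv)
    have := mul_pos (by linarith : 0 < P^2 - D^2 - (Z1^2+Z2^2)) this
    positivity

lemma levi_pos (K b c w1 w2 y1 y2 p1 p2 q1 q2 s : ℝ) (hs : s = 1+b^2+c^2) (hK : 0 < K)
    (hb : |b| ≤ 1/16) (hc : |c| ≤ 1/16)
    (hw : 0 < w1^2+w2^2+(y1^2+y2^2)) (hp : 0 < p1^2+p2^2+q1^2+q2^2) :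
    0 < G2 K s w1 w2 y1 y2 (p1-(c*q1-b*q2)) (p2-(b*q1+c*q2)) q1 q2 (p1-(c*q1-b*q2)) (p2-(b*q1+c*q2)) q1 q2
      + G2 K s w1 w2 y1 y2 (-q1-(c*p1-b*p2)) (-q2-(b*p1+c*p2)) p1 p2 (-q1-(c*p1-b*p2)) (-q2-(b*p1+c*p2)) p1 p2 := by
  set m := w1^2+w2^2 with hm
  set n := y1^2+y2^2 with hn
  obtain ⟨d1, d2⟩ := det_pos b c m n (w1*y1+w2*y2) (w1*y2-w2*y1) s (m+s*n) hb hc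
    (by positivity) (by positivity) (by rw [hm, hn]; ring) hs rfl hw
  have h := herm_pos _ (2*b*(4*m*n+s*n^2) + 4*(m+s*n)*(w1*y2-w2*y1))
    (2*n*((1+c^2-b^2)*(w1^2-w2^2) + 2*b*c*(2*w1*w2)) + 2*s*m*(y1^2-y2^2)
      - 4*(m+s*n)*(c*(w1*y1-w2*y2) + b*(w1*y2+w2*y1)))
    (2*n*(2*b*c*(w1^2-w2^2) - (1+c^2-b^2)*(2*w1*w2)) - 2*s*m*(2*y1*y2)
      - 4*(m+s*n)*(b*(w1*y1-w2*y2) - c*(w1*y2+w2*y1)))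
    (p1-q2) (q1+p2) (p1+q2) (q1-p2) d1 (by
      refine lt_of_eq_of_lt ?_ d2
      rw [hm, hn, hs]; ring) (by linarith)
  have h' := mul_pos hK h
  refine lt_of_lt_of_eq h' ?_
  unfold G2
  rw [hm, hn, hs]; ring

end PshBlock

/-- For `n = 2`, `M = (A + iI)ℝ²` with `A = [[c,-b],[b,c]]`, `|b|,|c| ≤ 1/16`,
the function `ρ = d_M² d_N + d_M d_N²` is strictly plurisubharmonic on `ℂ² ∖ {0}`. -/
theorem psh_complex_block (b c : ℝ) (hb : |b| ≤ 1/16) (hc : |c| ≤ 1/16) :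
    let dM : (Fin 2 → ℝ) × (Fin 2 → ℝ) → ℝ :=
      fun p => ((p.1 0 - c * p.2 0 + b * p.2 1) ^ 2
        + (p.1 1 - c * p.2 1 - b * p.2 0) ^ 2) / (1 + b ^ 2 + c ^ 2)
    let dN : (Fin 2 → ℝ) × (Fin 2 → ℝ) → ℝ := fun p => (p.2 0) ^ 2 + (p.2 1) ^ 2
    let ρ : (Fin 2 → ℝ) × (Fin 2 → ℝ) → ℝ :=
      fun p => (dM p) ^ 2 * dN p + dM p * (dN p) ^ 2
    ∀ p : (Fin 2 → ℝ) × (Fin 2 → ℝ), p ≠ 0 → StrictlyPlurisubharmonicAt ρ p := by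
  intro dM dN ρ p hp ξ hξ
  have hs0 : (1 + b^2 + c^2 : ℝ) ≠ 0 := by positivity
  set s : ℝ := 1 + b^2 + c^2 with hs
  have hρ : ρ = fun p : (Fin 2 → ℝ) × (Fin 2 → ℝ) => PshBlock.G0 (1/s^2) s (p.1 0 - c * p.2 0 + b * p.2 1) (p.1 1 - c * p.2 1 - b * p.2 0) (p.2 0) (p.2 1) := by
    funext p
    simp only [ρ, dM, dN, PshBlock.G0]
    rw [← hs]
    clear_value s
    field_simp
  have hw : 0 < (p.1 0 - c * p.2 0 + b * p.2 1)^2 + (p.1 1 - c * p.2 1 - b * p.2 0)^2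
      + ((p.2 0)^2 + (p.2 1)^2) := by
    refine lt_of_le_of_ne (by positivity) ?_
    intro h
    apply hp
    have hy0 : p.2 0 = 0 := by
      apply pow_eq_zero_iff (two_ne_zero) |>.1
      linarith [sq_nonneg (p.1 0 - c * p.2 0 + b * p.2 1), sq_nonneg (p.1 1 - c * p.2 1 - b * p.2 0), sq_nonneg (p.2 0), sq_nonneg (p.2 1)]
    have hy1 : p.2 1 = 0 := by
      apply pow_eq_zero_iff (two_ne_zero) |>.1
      linarith [sq_nonneg (p.1 0 - c * p.2 0 + b * p.2 1), sq_nonneg (p.1 1 - c * p.2 1 - b * p.2 0), sq_nonneg (p.2 0), sq_nonneg (p.2 1)]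
    rw [hy0, hy1] at h
    have hx0 : p.1 0 = 0 := by
      apply pow_eq_zero_iff (two_ne_zero) |>.1
      linarith [sq_nonneg (p.1 0), sq_nonneg (p.1 1)]
    have hx1 : p.1 1 = 0 := by
      apply pow_eq_zero_iff (two_ne_zero) |>.1
      linarith [sq_nonneg (p.1 0), sq_nonneg (p.1 1)]
    ext i
    · fin_cases i <;> simp [hx0, hx1]
    · fin_cases i <;> simp [hy0, hy1]
  have hξ' : 0 < (ξ 0).re^2 + (ξ 1).re^2 + (ξ 0).im^2 + (ξ 1).im^2 := by
    refine lt_of_le_of_ne (by positivity) ?_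
    intro h
    apply hξ
    ext i
    fin_cases i
    · apply Complex.ext
      · apply pow_eq_zero_iff (two_ne_zero) |>.1
        change (ξ 0).re ^ 2 = 0
        linarith [sq_nonneg (ξ 0).re, sq_nonneg (ξ 1).re, sq_nonneg (ξ 0).im, sq_nonneg (ξ 1).im]
      · apply pow_eq_zero_iff (two_ne_zero) |>.1
        change (ξ 0).im ^ 2 = 0
        linarith [sq_nonneg (ξ 0).re, sq_nonneg (ξ 1).re, sq_nonneg (ξ 0).im, sq_nonneg (ξ 1).im]
    · apply Complex.ext
      · apply pow_eq_zero_iff (two_ne_zero) |>.1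
        change (ξ 1).re ^ 2 = 0
        linarith [sq_nonneg (ξ 0).re, sq_nonneg (ξ 1).re, sq_nonneg (ξ 0).im, sq_nonneg (ξ 1).im]
      · apply pow_eq_zero_iff (two_ne_zero) |>.1
        change (ξ 1).im ^ 2 = 0
        linarith [sq_nonneg (ξ 0).re, sq_nonneg (ξ 1).re, sq_nonneg (ξ 0).im, sq_nonneg (ξ 1).im]
  have hpos := PshBlock.levi_pos (1/s^2) b c _ _ _ _ _ _ _ _ s hs (by positivity) hb hc hw hξ'
  have hpos4 := mul_pos (by norm_num : (0:ℝ) < 1/4) hpos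
  refine lt_of_lt_of_eq hpos4 ?_
  have h14 : (1/4 : ℂ) = ((1/4 : ℝ) : ℂ) := by norm_num
  rw [hρ]
  simp only [Fin.sum_univ_two, leviEntry, PshBlock.dX0_G0, PshBlock.dX1_G0, PshBlock.dY0_G0,
    PshBlock.dY1_G0, PshBlock.dX0_G1, PshBlock.dX1_G1, PshBlock.dY0_G1, PshBlock.dY1_G1, h14,
    Complex.add_re, Complex.mul_re, Complex.mul_im, Complex.add_im, Complex.ofReal_re,
    Complex.ofReal_im, Complex.I_re, Complex.I_im, Complex.conj_re, Complex.conj_im]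
  unfold PshBlock.G2
  clear_value s
  generalize (p.1 0 - c * p.2 0 + b * p.2 1) = w1
  generalize (p.1 1 - c * p.2 1 - b * p.2 0) = w2
  generalize p.2 0 = y1
  generalize p.2 1 = y2
  generalize 1 / s ^ 2 = K
  ring
end
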